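/- arXiv:2502.20346 — 2 statements merged into one kernel-verified Lean document; each statement's English description precedes it below -/
import Mathlib

section
/- Consider a price competition instance with an additive buyer (every subset of modules is feasible) in which the ratios v(i)/c(i) are pairwise distinct, and define CPV* = sup{ t ∈ ℝ : Σ_i v(i)·t·1[c(i) ≤ v(i)·t] ≤ B }. Then for every ε > 0 there exists δ ≥ 0 such that the price vector p defined by p(i) = max{ (CPV* − δ)·v(i), c(i) } is an ε-equilibrium of the pricing game in which the platform selects modules using the bang-per-buck greedy knapsack algorithm. -/
open Finset
open scoped Classical

noncomputable section

/-- Comparison for the bang-per-buck order: module `i` comes before module `j` if it has strictly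
higher bang-per-buck `v i / p i`, ties broken by a fixed rule (lower index first). -/
noncomputable def bpbLE {n : ℕ} (v p : Fin n → ℝ) (i j : Fin n) : Bool :=
  decide (v i / p i > v j / p j ∨ (v i / p i = v j / p j ∧ i ≤ j))

/-- The list of modules sorted in decreasing bang-per-buck order. -/
noncomputable def bpbOrder {n : ℕ} (v p : Fin n → ℝ) : List (Fin n) :=
  (List.finRange n).mergeSort (bpbLE v p)

/-- One step of the greedy knapsack algorithm: given the current state (selected set, stopped flag)
and the next module `i` in the order, add `i` if it fits in the budget, and otherwise terminate. -/
noncomputable def knapStep {n : ℕ} (p : Fin n → ℝ) (B : ℝ)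
    (st : Finset (Fin n) × Bool) (i : Fin n) : Finset (Fin n) × Bool :=
  if st.2 then st
  else if (∑ j ∈ st.1, p j) + p i > B then (st.1, true)
  else (insert i st.1, false)

/-- The set `S_p` selected by the bang-per-buck greedy knapsack algorithm at prices `p`. -/
noncomputable def knapSelect {n : ℕ} (v p : Fin n → ℝ) (B : ℝ) : Finset (Fin n) :=
  ((bpbOrder v p).foldl (knapStep p B) (∅, false)).1

/-- Module `i`'s utility at prices `p`. -/
noncomputable def knapUtil {n : ℕ} (v c p : Fin n → ℝ) (B : ℝ) (i : Fin n) : ℝ :=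
  if i ∈ knapSelect v p B then p i - c i else 0

/-- `p` is an ε-equilibrium: every price is in `[c i, B]` and no module can gain more than `ε`
by a unilateral deviation to another price in `[c i, B]`. -/
def IsKnapEpsEq {n : ℕ} (v c : Fin n → ℝ) (B ε : ℝ) (p : Fin n → ℝ) : Prop :=
  (∀ i, c i ≤ p i ∧ p i ≤ B) ∧
  ∀ i : Fin n, ∀ q : ℝ, c i ≤ q → q ≤ B →
    knapUtil v c (Function.update p i q) B i ≤ knapUtil v c p B i + ε

end

theorem aux_fold_stop {n : ℕ} (p : Fin n → ℝ) (B : ℝ) (l : List (Fin n))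
    (S : Finset (Fin n)) : l.foldl (knapStep p B) (S, true) = (S, true) := by
  induction l with
  | nil => rfl
  | cons a l ih => simpa [knapStep] using ih

theorem aux_fold_mono {n : ℕ} (p : Fin n → ℝ) (B : ℝ) (l : List (Fin n)) :
    ∀ st : Finset (Fin n) × Bool, st.1 ⊆ (l.foldl (knapStep p B) st).1 := by
  induction l with
  | nil => intro st; exact subset_rfl
  | cons a l ih =>
    intro st
    refine Finset.Subset.trans ?_ (ih (knapStep p B st a))
    unfold knapStep
    split_ifs
    · exact subset_rfl
    · exact subset_rfl
    · exact Finset.subset_insert _ _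

theorem aux_fold_inv {n : ℕ} (p : Fin n → ℝ) (B : ℝ) (l : List (Fin n)) :
    (l.foldl (knapStep p B) (∅, false)).1 ⊆ l.toFinset ∧
    ((l.foldl (knapStep p B) (∅, false)).2 = false →
      (l.foldl (knapStep p B) (∅, false)).1 = l.toFinset) := by
  induction l using List.reverseRecOn with
  | nil => simp
  | append_singleton l a ih =>
    rw [List.foldl_append]
    simp only [List.foldl_cons, List.foldl_nil]
    obtain ⟨h1, h2⟩ := ih
    generalize l.foldl (knapStep p B) (∅, false) = st at h1 h2
    have e : (l ++ [a]).toFinset = insert a l.toFinset := by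
      ext x; simp [or_comm]
    rw [e]
    unfold knapStep
    split_ifs with hs hb
    · exact ⟨h1.trans (Finset.subset_insert _ _), fun h => by simp [hs] at h⟩
    · exact ⟨h1.trans (Finset.subset_insert _ _), fun h => by simp at h⟩
    · exact ⟨Finset.insert_subset_insert _ h1, fun _ => by
        simp only; rw [h2 (by simpa using hs)]⟩

theorem aux_fold_all {n : ℕ} (p : Fin n → ℝ) (B : ℝ) (hp : ∀ i, 0 ≤ p i) (l : List (Fin n))
    (hl : l.Nodup) (hB : ∑ j ∈ l.toFinset, p j ≤ B) :
    l.foldl (knapStep p B) (∅, false) = (l.toFinset, false) := by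
  induction l using List.reverseRecOn with
  | nil => simp
  | append_singleton l a ih =>
    have e : (l ++ [a]).toFinset = insert a l.toFinset := by
      ext x; simp [or_comm]
    have hn : l.Nodup ∧ a ∉ l := by
      rw [List.nodup_append] at hl
      refine ⟨hl.1, fun h => hl.2.2 a h a (by simp) rfl⟩
    rw [e, Finset.sum_insert (by simpa using hn.2)] at hB
    rw [List.foldl_append, ih hn.1 (by linarith [hp a]), e]
    simp only [List.foldl_cons, List.foldl_nil, knapStep]
    rw [if_neg (by simp), if_neg (by linarith)]

theorem aux_split {n : ℕ} (v p : Fin n → ℝ) (i : Fin n) :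
    ∃ l1 l2 : List (Fin n), bpbOrder v p = l1 ++ i :: l2 ∧ (l1 ++ i :: l2).Nodup ∧
      (∀ j, v j / p j > v i / p i → j ∈ l1) ∧ (∀ j ∈ l1, v j / p j ≥ v i / p i) := by
  have hperm : (bpbOrder v p).Perm (List.finRange n) := List.mergeSort_perm _ _
  have hnd : (bpbOrder v p).Nodup := hperm.nodup_iff.2 (List.nodup_finRange n)
  have hmem : ∀ j, j ∈ bpbOrder v p := fun j => hperm.mem_iff.2 (List.mem_finRange j)
  have hpw : (bpbOrder v p).Pairwise (fun a b => bpbLE v p a b = true) := by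
    apply List.pairwise_mergeSort
    · intro a b c
      simp only [bpbLE, decide_eq_true_eq]
      rintro (h | ⟨h, h'⟩) (g | ⟨g, g'⟩)
      · left; linarith
      · left; linarith
      · left; linarith
      · right; exact ⟨h.trans g, h'.trans g'⟩
    · intro a b
      simp only [bpbLE, Bool.or_eq_true, decide_eq_true_eq]
      rcases lt_trichotomy (v a / p a) (v b / p b) with h | h | h
      · right; left; exact h
      · rcases le_total a b with g | g
        · left; right; exact ⟨h, g⟩
        · right; right; exact ⟨h.symm, g⟩
      · left; left; exact h
  obtain ⟨l1, l2, e⟩ := List.append_of_mem (hmem i)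
  rw [e] at hnd hpw hmem
  refine ⟨l1, l2, e, hnd, ?_, ?_⟩
  · intro j hj
    have := hmem j
    simp only [List.mem_append, List.mem_cons] at this
    rcases this with h | h | h
    · exact h
    · subst h; exact absurd hj (lt_irrefl _)
    · have h3 := (List.pairwise_cons.1 (List.pairwise_append.1 hpw).2.1).1 j h
      simp only [bpbLE, decide_eq_true_eq] at h3
      rcases h3 with h3 | h3
      · linarith
      · linarith [h3.1]
  · intro j hj
    have h3 := (List.pairwise_append.1 hpw).2.2 j hj i (by simp)
    simp only [bpbLE, decide_eq_true_eq] at h3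
    rcases h3 with h3 | h3
    · exact h3.le
    · exact h3.1.ge

theorem aux_selected_le {n : ℕ} (v p : Fin n → ℝ) (B : ℝ) (hp : ∀ i, 0 ≤ p i) (i : Fin n)
    (hi : i ∈ knapSelect v p B) (T : Finset (Fin n))
    (hT : ∀ j ∈ T, v j / p j > v i / p i) : ∑ j ∈ T, p j + p i ≤ B := by
  obtain ⟨l1, l2, e, hnd, h1, -⟩ := aux_split v p i
  have hil : i ∉ l1 := by
    intro h
    rw [List.nodup_append] at hnd
    exact hnd.2.2 i h i (by simp) rfl
  unfold knapSelect at hi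
  rw [e, List.foldl_append, List.foldl_cons] at hi
  obtain ⟨a1, a2⟩ := aux_fold_inv p B l1
  generalize l1.foldl (knapStep p B) (∅, false) = st at hi a1 a2
  obtain ⟨S, b⟩ := st
  have hiS : i ∉ S := fun h => hil (by simpa using a1 h)
  cases b with
  | true =>
    have : knapStep p B (S, true) i = (S, true) := by simp [knapStep]
    rw [this, aux_fold_stop] at hi
    exact absurd hi hiS
  | false =>
    have hS : S = l1.toFinset := a2 rfl
    by_contra hcon
    have hle : ∑ j ∈ T, p j ≤ ∑ j ∈ S, p j := by
      apply Finset.sum_le_sum_of_subset_of_nonneg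
      · intro j hj
        rw [hS]; simpa using h1 j (hT j hj)
      · intro j _ _; exact hp j
    have : knapStep p B (S, false) i = (S, true) := by
      unfold knapStep
      rw [if_neg (by simp), if_pos (by simp only; linarith)]
    rw [this, aux_fold_stop] at hi
    exact hiS hi

theorem aux_mem_select {n : ℕ} (v p : Fin n → ℝ) (B : ℝ) (hp : ∀ i, 0 ≤ p i) (i : Fin n)
    (T : Finset (Fin n)) (hT : ∀ j, v j / p j ≥ v i / p i → j ∈ T)
    (hB : ∑ j ∈ T, p j ≤ B) : i ∈ knapSelect v p B := by
  obtain ⟨l1, l2, e, hnd, -, h2⟩ := aux_split v p i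
  have e2 : l1 ++ i :: l2 = (l1 ++ [i]) ++ l2 := by simp
  unfold knapSelect
  rw [e, e2, List.foldl_append]
  apply aux_fold_mono
  rw [aux_fold_all p B hp]
  · simp
  · rw [e2] at hnd
    exact (List.nodup_append.1 hnd).1
  · refine le_trans (Finset.sum_le_sum_of_subset_of_nonneg ?_ (fun j _ _ => hp j)) hB
    intro j hj
    simp only [List.mem_toFinset, List.mem_append, List.mem_singleton] at hj
    rcases hj with h | h
    · exact hT j (h2 j h)
    · subst h; exact hT j (le_refl _)

theorem aux_main {n : ℕ} (v c : Fin n → ℝ) (B C t ε : ℝ)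
    (hv : ∀ i, 0 < v i) (hc : ∀ i, 0 ≤ c i) (hcB : ∀ i, c i ≤ B)
    (ht : 0 < t) (htC : t ≤ C) (hε : 0 < ε) (hgain : ∀ i, (C - t) * v i ≤ ε)
    (hF : ∑ i ∈ univ.filter (fun i => c i ≤ v i * t), v i * t ≤ B)
    (hG : B ≤ ∑ i ∈ univ.filter (fun i => c i ≤ v i * C), max (t * v i) (c i)) :
    IsKnapEpsEq v c B ε (fun i => max (t * v i) (c i)) := by
  have hC : 0 < C := lt_of_lt_of_le ht htC
  have hpos : ∀ i, 0 < max (t * v i) (c i) := fun i =>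
    lt_max_of_lt_left (mul_pos ht (hv i))
  refine ⟨fun i => ⟨le_max_right _ _, max_le ?_ (hcB i)⟩, ?_⟩
  · by_cases h : c i ≤ v i * t
    · refine le_trans ?_ hF
      rw [mul_comm]
      exact Finset.single_le_sum (f := fun i => v i * t)
        (fun j _ => (mul_pos (hv j) ht).le) (by simpa using h)
    · push Not at h
      linarith [hcB i, mul_comm t (v i)]
  intro i q hcq hqB
  have hcur : max (t * v i) (c i) - c i ≤ knapUtil v c (fun i => max (t * v i) (c i)) B i := by
    unfold knapUtil
    by_cases h : c i ≤ v i * t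
    · rw [if_pos]
      apply aux_mem_select v _ B (fun j => (hpos j).le) i
        (univ.filter (fun i => c i ≤ v i * t))
      · intro j hj
        simp only [Finset.mem_filter, Finset.mem_univ, true_and]
        by_contra hcon
        push Not at hcon
        have e1 : max (t * v i) (c i) = t * v i := max_eq_left (by linarith [mul_comm t (v i)])
        have e2 : max (t * v j) (c j) = c j := max_eq_right (by linarith [mul_comm t (v j)])
        have hcj : 0 < c j := lt_trans (mul_pos (hv j) ht) hcon
        rw [e1, e2, ge_iff_le, div_le_div_iff₀ (mul_pos ht (hv i)) hcj] at hj
        have := mul_lt_mul_of_pos_left hcon (hv i)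
        linarith [mul_comm t (v i), show v j * (t * v i) = v i * (v j * t) by ring]
      · refine le_trans (le_of_eq (Finset.sum_congr rfl ?_)) hF
        intro j hj
        simp only [Finset.mem_filter, Finset.mem_univ, true_and] at hj
        rw [max_eq_left (by linarith [mul_comm t (v j)]), mul_comm]
    · push Not at h
      have e2 : max (t * v i) (c i) = c i := max_eq_right (by linarith [mul_comm t (v i)])
      simp only [e2, sub_self]
      split_ifs <;> simp
  have hcur0 : 0 ≤ max (t * v i) (c i) - c i := by linarith [le_max_right (t * v i) (c i)]
  suffices h : knapUtil v c (Function.update (fun i => max (t * v i) (c i)) i q) B i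
      ≤ max (t * v i) (c i) - c i + ε by linarith
  by_cases hq : q ≤ v i * C
  · have : q - c i ≤ max (t * v i) (c i) - c i + ε := by
      have := hgain i
      have h2 := le_max_left (t * v i) (c i)
      nlinarith
    unfold knapUtil
    split_ifs
    · simpa using this
    · linarith
  · push Not at hq
    have hq0 : 0 < q := lt_trans (mul_pos (hv i) hC) hq
    unfold knapUtil
    rw [if_neg]
    · linarith
    intro hmem
    set T := univ.filter (fun i => c i ≤ v i * C) with hTdef
    have hne : ∀ j ∈ T.erase i, Function.update (fun i => max (t * v i) (c i)) i q j
        = max (t * v j) (c j) := fun j hj =>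
      Function.update_of_ne (Finset.ne_of_mem_erase hj) _ _
    have key := aux_selected_le v _ B (fun j => by
      by_cases h : j = i
      · subst h; simpa using hq0.le
      · rw [Function.update_of_ne h]; exact (hpos j).le) i hmem (T.erase i) (by
      intro j hj
      rw [hne j hj, Function.update_self, gt_iff_lt, div_lt_div_iff₀ hq0 (hpos j)]
      have hjT : c j ≤ v j * C := by
        have := Finset.mem_of_mem_erase hj
        simpa [hTdef] using this
      have hle : max (t * v j) (c j) ≤ v j * C :=
        max_le (by rw [mul_comm]; exact mul_le_mul_of_nonneg_left htC (hv j).le) hjT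
      calc v i * max (t * v j) (c j) ≤ v i * (v j * C) :=
            mul_le_mul_of_nonneg_left hle (hv i).le
        _ = v j * (v i * C) := by ring
        _ < v j * q := mul_lt_mul_of_pos_left hq (hv j))
    rw [Finset.sum_congr rfl hne, Function.update_self] at key
    by_cases hiT : i ∈ T
    · have h3 := Finset.add_sum_erase T (fun j => max (t * v j) (c j)) hiT
      have hiT' : c i ≤ v i * C := by simpa [hTdef] using hiT
      have hle : max (t * v i) (c i) ≤ v i * C :=
        max_le (by rw [mul_comm]; exact mul_le_mul_of_nonneg_left htC (hv i).le) hiT'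
      linarith
    · rw [Finset.erase_eq_of_notMem hiT] at key
      linarith

/-- For an additive buyer with pairwise distinct ratios `v i / c i`, letting
`CPV* = sup { t : Σ_i v i * t * 1[c i ≤ v i * t] ≤ B }`, for every `ε > 0` there is `δ ≥ 0`
such that the prices `p i = max ((CPV* - δ) * v i) (c i)` form an ε-equilibrium of the pricing
game with the bang-per-buck greedy knapsack selection rule. -/
theorem statement0 (n : ℕ) (v c : Fin n → ℝ) (B : ℝ)
    (hv : ∀ i, 0 < v i) (hc : ∀ i, 0 ≤ c i) (hcB : ∀ i, c i ≤ B) (hB : 0 < B)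
    (hdist : ∀ i j : Fin n, i ≠ j → v i / c i ≠ v j / c j)
    (CPV : ℝ)
    (hCPV : CPV = sSup {t : ℝ | (∑ i, v i * t * (if c i ≤ v i * t then (1 : ℝ) else 0)) ≤ B})
    (ε : ℝ) (hε : 0 < ε) :
    ∃ δ : ℝ, 0 ≤ δ ∧
      IsKnapEpsEq v c B ε (fun i => max ((CPV - δ) * v i) (c i)) := by
  rcases Nat.eq_zero_or_pos n with hn | hn
  · subst hn
    exact ⟨0, le_refl _, fun i => i.elim0, fun i => i.elim0⟩
  let i0 : Fin n := ⟨0, hn⟩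
  have hFeq : ∀ t : ℝ, (∑ i, v i * t * (if c i ≤ v i * t then (1 : ℝ) else 0))
      = ∑ i ∈ univ.filter (fun i => c i ≤ v i * t), v i * t := by
    intro t
    rw [Finset.sum_filter]
    refine Finset.sum_congr rfl fun i _ => ?_
    split_ifs <;> simp
  simp only [hFeq] at hCPV
  set A : Set ℝ := {t : ℝ | ∑ i ∈ univ.filter (fun i => c i ≤ v i * t), v i * t ≤ B} with hA
  have hbdd : BddAbove A := by
    refine ⟨max (c i0 / v i0) (B / v i0), fun t ht => ?_⟩
    by_contra hcon
    push Not at hcon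
    obtain ⟨h1, h2⟩ := max_lt_iff.1 hcon
    rw [div_lt_iff₀ (hv i0)] at h1 h2
    have ht0 : 0 < t := by
      have : 0 ≤ c i0 / v i0 := div_nonneg (hc i0) (hv i0).le
      exact lt_of_le_of_lt (this.trans (le_max_left _ _)) hcon
    have : v i0 * t ≤ ∑ i ∈ univ.filter (fun i => c i ≤ v i * t), v i * t :=
      Finset.single_le_sum (f := fun i => v i * t)
        (fun j _ => (mul_pos (hv j) ht0).le) (by simp; linarith [mul_comm t (v i0)])
    have h3 : ∑ i ∈ univ.filter (fun i => c i ≤ v i * t), v i * t ≤ B := ht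
    linarith [mul_comm t (v i0)]
  have hVpos : 0 < ∑ i, v i := Finset.sum_pos (fun i _ => hv i) ⟨i0, Finset.mem_univ _⟩
  have hmem0 : B / ∑ i, v i ∈ A := by
    have ht0 : 0 < B / ∑ i, v i := div_pos hB hVpos
    show ∑ i ∈ univ.filter (fun i => c i ≤ v i * (B / ∑ i, v i)), v i * (B / ∑ i, v i) ≤ B
    refine le_trans (Finset.sum_le_sum_of_subset_of_nonneg (Finset.filter_subset _ _)
      (fun j _ _ => (mul_pos (hv j) ht0).le)) ?_
    rw [← Finset.sum_mul]
    field_simp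
    exact le_refl _
  have hCpos : 0 < CPV := by
    rw [hCPV]
    exact lt_of_lt_of_le (div_pos hB hVpos) (le_csSup hbdd hmem0)
  have hbelow : ∀ t, 0 < t → t < CPV → t ∈ A := by
    intro t ht0 ht
    rw [hCPV] at ht
    obtain ⟨s, hs, hts⟩ := exists_lt_of_lt_csSup ⟨_, hmem0⟩ ht
    have hs' : ∑ i ∈ univ.filter (fun i => c i ≤ v i * s), v i * s ≤ B := hs
    show ∑ i ∈ univ.filter (fun i => c i ≤ v i * t), v i * t ≤ B
    refine le_trans ?_ hs'
    refine le_trans (Finset.sum_le_sum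
      (fun j _ => mul_le_mul_of_nonneg_left hts.le (hv j).le)) ?_
    refine Finset.sum_le_sum_of_subset_of_nonneg ?_
      (fun j _ _ => (mul_pos (hv j) (ht0.trans hts)).le)
    intro j hj
    simp only [Finset.mem_filter, Finset.mem_univ, true_and] at hj ⊢
    exact hj.trans (mul_le_mul_of_nonneg_left hts.le (hv j).le)
  have hge : B ≤ ∑ i ∈ univ.filter (fun i => c i ≤ v i * CPV), v i * CPV := by
    by_contra hcon
    push Not at hcon
    have e1 : ∀ᶠ s in nhds CPV, ∑ i ∈ univ.filter (fun i => c i ≤ v i * CPV), v i * s < B := by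
      have hcont : Continuous
          (fun s : ℝ => ∑ i ∈ univ.filter (fun i => c i ≤ v i * CPV), v i * s) := by fun_prop
      exact hcont.continuousAt.eventually_lt continuousAt_const hcon
    have e2 : ∀ᶠ s in nhds CPV, ∀ i, v i * CPV < c i → v i * s < c i := by
      rw [Filter.eventually_all]
      intro i
      by_cases h : v i * CPV < c i
      · have hcont : Continuous (fun s : ℝ => v i * s) := by fun_prop
        filter_upwards [hcont.continuousAt.eventually_lt continuousAt_const h] with s hs _
        exact hs
      · exact Filter.Eventually.of_forall fun s h' => absurd h' h
    have e3 := ((e1.and e2).filter_mono nhdsWithin_le_nhds).and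
      (self_mem_nhdsWithin : Set.Ioi CPV ∈ nhdsWithin CPV (Set.Ioi CPV))
    obtain ⟨s, ⟨h1, h2⟩, h3⟩ := e3.exists
    have h3' : CPV < s := h3
    have hsA : s ∈ A := by
      show ∑ i ∈ univ.filter (fun i => c i ≤ v i * s), v i * s ≤ B
      refine le_trans (Finset.sum_le_sum_of_subset_of_nonneg ?_
        (fun j _ _ => (mul_pos (hv j) (hCpos.trans h3')).le)) h1.le
      intro j hj
      simp only [Finset.mem_filter, Finset.mem_univ, true_and] at hj ⊢
      by_contra hj'
      push Not at hj'
      linarith [h2 j hj']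
    have := le_csSup hbdd hsA
    rw [← hCPV] at this
    linarith
  have hGC : ∑ i ∈ univ.filter (fun i => c i ≤ v i * CPV), max (CPV * v i) (c i)
      = ∑ i ∈ univ.filter (fun i => c i ≤ v i * CPV), v i * CPV := by
    refine Finset.sum_congr rfl fun j hj => ?_
    simp only [Finset.mem_filter, Finset.mem_univ, true_and] at hj
    rw [max_eq_left (by linarith [mul_comm CPV (v j)]), mul_comm]
  by_cases hle : CPV ∈ A
  · refine ⟨0, le_refl _, ?_⟩
    rw [sub_zero]
    refine aux_main v c B CPV CPV ε hv hc hcB hCpos le_rfl hε ?_ hle ?_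
    · intro i; simp [hε.le]
    · rw [hGC]; exact hge
  · have hgt : B < ∑ i ∈ univ.filter (fun i => c i ≤ v i * CPV), max (CPV * v i) (c i) := by
      rw [hGC]
      by_contra h
      exact hle (not_lt.1 h)
    have e1 : ∀ᶠ s in nhds CPV,
        B < ∑ i ∈ univ.filter (fun i => c i ≤ v i * CPV), max (s * v i) (c i) := by
      have hcont : Continuous (fun s : ℝ =>
          ∑ i ∈ univ.filter (fun i => c i ≤ v i * CPV), max (s * v i) (c i)) := by fun_prop
      exact continuousAt_const.eventually_lt hcont.continuousAt hgt
    have e2 : ∀ᶠ s in nhds CPV, ∀ i, (CPV - s) * v i < ε := by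
      rw [Filter.eventually_all]
      intro i
      have hcont : Continuous (fun s : ℝ => (CPV - s) * v i) := by fun_prop
      exact hcont.continuousAt.eventually_lt continuousAt_const (by simpa using hε)
    have e3 := ((e1.and (e2.and (lt_mem_nhds hCpos))).filter_mono nhdsWithin_le_nhds).and
      (self_mem_nhdsWithin : Set.Iio CPV ∈ nhdsWithin CPV (Set.Iio CPV))
    obtain ⟨s, ⟨h1, h2, h0⟩, h3⟩ := e3.exists
    have h3' : s < CPV := h3
    refine ⟨CPV - s, by linarith, ?_⟩
    rw [sub_sub_cancel]
    exact aux_main v c B CPV s ε hv hc hcB h0 h3'.le hε (fun i => (h2 i).le)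
      (hbelow s h0 h3') h1.le
end

section
/- Run the weighted-matroid greedy algorithm on prices p with bang-per-buck order π, and let G_k denote its working set after processing the first k modules π(1), …, π(k). If every intermediate set G' considered through step k satisfies p(G') < B (so the algorithm has not terminated), then G_k is a maximum-value independent set of the matroid restricted to the ground set {π(1), …, π(k)}: v(G_k) = max{ v(T) : T ⊆ {π(1),…,π(k)}, T independent }. -/
open Finset
open scoped Classical

noncomputable section

/-- `C` is a circuit of the matroid `M`: a minimal dependent set. -/
def IsCircuit {n : ℕ} (M : Matroid (Fin n)) (C : Finset (Fin n)) : Prop :=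
  ¬ M.Indep (↑C : Set (Fin n)) ∧ ∀ x ∈ C, M.Indep (↑(C.erase x) : Set (Fin n))

/-- The module removed when module `i` is spanned by the current set `G`: a minimum-value module
of the (unique) circuit contained in `G ∪ {i}`. -/
noncomputable def swapOut {n : ℕ} (M : Matroid (Fin n)) (v : Fin n → ℝ)
    (G : Finset (Fin n)) (i : Fin n) : Fin n :=
  if h : ∃ j, ∃ C : Finset (Fin n), C ⊆ insert i G ∧ IsCircuit M C ∧ j ∈ C ∧
      ∀ k ∈ C, v j ≤ v k then
    h.choose
  else i

/-- One step of the weighted-matroid greedy algorithm: when considering module `i`, if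
`i ∈ span G` then the candidate set `G'` is `(G ∪ {i})` minus a minimum-value module of the unique
circuit in `G ∪ {i}`, and otherwise `G' = G ∪ {i}`; if `p(G') > B` the algorithm terminates
returning `G`, else it continues with `G'`. -/
noncomputable def wStep {n : ℕ} (M : Matroid (Fin n)) (v p : Fin n → ℝ) (B : ℝ)
    (st : Finset (Fin n) × Bool) (i : Fin n) : Finset (Fin n) × Bool :=
  if st.2 then st
  else
    let G' : Finset (Fin n) :=
      if i ∈ M.closure (↑st.1 : Set (Fin n)) then
        (insert i st.1).erase (swapOut M v st.1 i)
      else insert i st.1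
    if (∑ j ∈ G', p j) > B then (st.1, true) else (G', false)

/-- The set `S_p` selected by the weighted-matroid greedy algorithm at prices `p`. -/
noncomputable def wSelect {n : ℕ} (M : Matroid (Fin n)) (v p : Fin n → ℝ) (B : ℝ) :
    Finset (Fin n) :=
  ((bpbOrder v p).foldl (wStep M v p B) (∅, false)).1

/-- Module `i`'s utility at prices `p`. -/
noncomputable def wUtil {n : ℕ} (M : Matroid (Fin n)) (v c p : Fin n → ℝ) (B : ℝ)
    (i : Fin n) : ℝ :=
  if i ∈ wSelect M v p B then p i - c i else 0

/-- `p` is an ε-equilibrium: every price is in `[c i, B]` and no module can gain more than `ε`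
by a unilateral deviation to another price in `[c i, B]`. -/
def IsWEpsEq {n : ℕ} (M : Matroid (Fin n)) (v c : Fin n → ℝ) (B ε : ℝ)
    (p : Fin n → ℝ) : Prop :=
  (∀ i, c i ≤ p i ∧ p i ≤ B) ∧
  ∀ i : Fin n, ∀ q : ℝ, c i ≤ q → q ≤ B →
    wUtil M v c (Function.update p i q) B i ≤ wUtil M v c p B i + ε

end

lemma isCircuit_iff_aux {n : ℕ} (M : Matroid (Fin n)) (hE : M.E = Set.univ)
    (C : Finset (Fin n)) : IsCircuit M C ↔ M.IsCircuit (↑C : Set (Fin n)) := by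
  rw [Matroid.isCircuit_iff_dep_forall_sdiff_singleton_indep, IsCircuit,
    Matroid.dep_iff]
  simp [hE]

/-- The greedy invariant: every processed module is spanned by selected modules of at least its
value. -/
def GInv {n : ℕ} (M : Matroid (Fin n)) (v : Fin n → ℝ) (S G : Finset (Fin n)) : Prop :=
  G ⊆ S ∧ M.Indep (↑G : Set (Fin n)) ∧
    ∀ e ∈ S, e ∈ M.closure {g | g ∈ G ∧ v e ≤ v g}

lemma GInv.optimal {n : ℕ} {M : Matroid (Fin n)} {v : Fin n → ℝ} (hv : ∀ i, 0 < v i)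
    {S G : Finset (Fin n)} (h : GInv M v S G) (T : Finset (Fin n)) (hTS : T ⊆ S)
    (hT : M.Indep (↑T : Set (Fin n))) : (∑ i ∈ T, v i) ≤ ∑ i ∈ G, v i := by
  obtain ⟨f, hf, hfG⟩ := (Finset.all_card_le_biUnion_card_iff_exists_injective
    (fun x : {x // x ∈ T} => G.filter (fun g => v x ≤ v g))).1 (by
      intro A
      set N := A.biUnion (fun x : {x // x ∈ T} => G.filter (fun g => v x ≤ v g)) with hN
      have hsub : (↑(A.map (Function.Embedding.subtype _)) : Set (Fin n)) ⊆ M.closure ↑N := by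
        intro x hx
        simp only [Finset.coe_map, Set.mem_image, Finset.mem_coe] at hx
        obtain ⟨y, hy, rfl⟩ := hx
        refine M.closure_subset_closure ?_ (h.2.2 _ (hTS y.2))
        intro g hg
        simp only [hN, Finset.mem_coe, Finset.mem_biUnion, Finset.mem_filter]
        exact ⟨y, hy, hg⟩
      have hind : M.Indep (↑(A.map (Function.Embedding.subtype _)) : Set (Fin n)) := by
        refine hT.subset ?_
        intro x hx
        simp only [Finset.coe_map, Set.mem_image, Finset.mem_coe] at hx
        obtain ⟨y, hy, rfl⟩ := hx
        exact y.2
      have h1 := hind.eRk_eq_encard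
      have h2 := M.eRk_mono hsub
      rw [M.eRk_closure_eq] at h2
      have h3 := h1 ▸ h2.trans (M.eRk_le_encard _)
      rw [Set.encard_coe_eq_coe_finsetCard, Set.encard_coe_eq_coe_finsetCard,
        Finset.card_map] at h3
      exact_mod_cast h3)
  simp only [Finset.mem_filter] at hfG
  calc ∑ i ∈ T, v i = ∑ x : {x // x ∈ T}, v x := (Finset.sum_coe_sort T v).symm
    _ ≤ ∑ x : {x // x ∈ T}, v (f x) := Finset.sum_le_sum fun x _ => (hfG x).2
    _ = ∑ y ∈ Finset.univ.image f, v y := (Finset.sum_image hf.injOn).symm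
    _ ≤ ∑ i ∈ G, v i := by
      refine Finset.sum_le_sum_of_subset_of_nonneg ?_ fun i _ _ => (hv i).le
      intro y hy
      simp only [Finset.mem_image, Finset.mem_univ, true_and] at hy
      obtain ⟨x, rfl⟩ := hy
      exact (hfG x).1

lemma GInv.step {n : ℕ} {M : Matroid (Fin n)} (hE : M.E = Set.univ) {v : Fin n → ℝ}
    {S G : Finset (Fin n)} (h : GInv M v S G) {i : Fin n} (hi : i ∉ S) :
    GInv M v (insert i S) (if i ∈ M.closure (↑G : Set (Fin n)) then
        (insert i G).erase (swapOut M v G i) else insert i G) := by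
  obtain ⟨hGS, hG, hc⟩ := h
  have hiG : i ∉ G := fun hh => hi (hGS hh)
  split_ifs with hcl
  · have hex : ∃ j, ∃ C : Finset (Fin n), C ⊆ insert i G ∧ IsCircuit M C ∧ j ∈ C ∧
        ∀ k ∈ C, v j ≤ v k := by
      have hC := hG.fundCircuit_isCircuit hcl (by simpa using hiG)
      obtain ⟨j, hj, hmin⟩ := Finset.exists_min_image (M.fundCircuit i ↑G).toFinset v
        ⟨i, by simpa using M.mem_fundCircuit i ↑G⟩
      refine ⟨j, (M.fundCircuit i ↑G).toFinset, ?_, ?_, hj, hmin⟩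
      · intro x hx
        have := M.fundCircuit_subset_insert i ↑G (Set.mem_toFinset.1 hx)
        simpa using this
      · rw [isCircuit_iff_aux M hE]
        simpa using hC
    have hsw : swapOut M v G i = hex.choose := by
      unfold swapOut
      rw [dif_pos hex]
    obtain ⟨C, hCs, hC, hjC, hmin⟩ := hex.choose_spec
    rw [← hsw] at hjC hmin
    generalize swapOut M v G i = j at hjC hmin
    rw [isCircuit_iff_aux M hE] at hC
    have hCs' : (↑C : Set (Fin n)) ⊆ insert i ↑G := by
      rw [← Finset.coe_insert]; exact_mod_cast hCs
    have hfund := hC.eq_fundCircuit_of_subset hG hCs'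
    have key : ∀ x ∈ insert i G, x ∈ M.closure {g | g ∈ (insert i G).erase j ∧ v x ≤ v g} := by
      intro x hx
      by_cases hxj : x = j
      · subst hxj
        refine M.closure_subset_closure ?_ (hC.mem_closure_sdiff_singleton_of_mem hjC)
        intro g hg
        exact ⟨Finset.mem_erase.2 ⟨hg.2, hCs hg.1⟩, hmin g hg.1⟩
      · exact M.mem_closure_of_mem ⟨Finset.mem_erase.2 ⟨hxj, hx⟩, le_rfl⟩ (by simp [hE])
    refine ⟨?_, ?_, ?_⟩
    · exact (Finset.erase_subset _ _).trans (Finset.insert_subset_insert _ hGS)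
    · rw [Finset.coe_erase, Finset.coe_insert]
      exact (hG.mem_fundCircuit_iff hcl (by simpa using hiG)).1 (hfund ▸ hjC)
    · intro e he
      rcases Finset.mem_insert.1 he with rfl | he
      · exact key _ (Finset.mem_insert_self _ _)
      · refine M.closure_subset_closure_of_subset_closure ?_ (hc e he)
        intro g hg
        refine M.closure_subset_closure ?_ (key g (Finset.mem_insert_of_mem hg.1))
        intro g' hg'
        exact ⟨hg'.1, hg.2.trans hg'.2⟩
  · refine ⟨Finset.insert_subset_insert _ hGS, ?_, ?_⟩
    · rw [Finset.coe_insert]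
      exact (hG.insert_indep_iff).2 (Or.inl ⟨by simp [hE], hcl⟩)
    · intro e he
      rcases Finset.mem_insert.1 he with rfl | he
      · exact M.mem_closure_of_mem ⟨Finset.mem_insert_self _ _, le_rfl⟩ (by simp [hE])
      · refine M.closure_subset_closure ?_ (hc e he)
        intro g hg
        exact ⟨Finset.mem_insert_of_mem hg.1, hg.2⟩

/-- Run the weighted-matroid greedy algorithm at prices `p`, and let `G_k` be
its working set after processing the first `k` modules of the bang-per-buck order.  If every
intermediate set considered through step `k` has total price strictly below `B` (so the
algorithm has not terminated), then `G_k` is a maximum-value independent set of the matroid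
restricted to the first `k` modules of the order. -/
theorem statement9 (n : ℕ) (M : Matroid (Fin n)) (hE : M.E = Set.univ)
    (v p : Fin n → ℝ) (B : ℝ)
    (hv : ∀ i, 0 < v i) (hp : ∀ i, 0 < p i) (hB : 0 < B)
    (k : ℕ) (hk : k ≤ n)
    (run : ℕ → Finset (Fin n) × Bool)
    (hrun : ∀ m : ℕ, run m = ((bpbOrder v p).take m).foldl (wStep M v p B) (∅, false))
    (hnostop : ∀ m : ℕ, m ≤ k → (run m).2 = false ∧ (∑ j ∈ (run m).1, p j) < B) :
    (run k).1 ⊆ ((bpbOrder v p).take k).toFinset ∧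
    M.Indep (↑(run k).1 : Set (Fin n)) ∧
    ∀ T : Finset (Fin n), T ⊆ ((bpbOrder v p).take k).toFinset →
      M.Indep (↑T : Set (Fin n)) → (∑ i ∈ T, v i) ≤ (∑ i ∈ (run k).1, v i) := by
  have hperm : (bpbOrder v p).Perm (List.finRange n) := List.mergeSort_perm _ _
  have hnd : (bpbOrder v p).Nodup := hperm.nodup_iff.2 (List.nodup_finRange n)
  have hlen : (bpbOrder v p).length = n := by simpa using hperm.length_eq
  have main : ∀ m, m ≤ k → GInv M v ((bpbOrder v p).take m).toFinset (run m).1 := by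
    intro m
    induction m with
    | zero =>
      intro _
      rw [hrun]
      simp [GInv]
    | succ m ih =>
      intro hm
      have ih := ih (by omega)
      have hml : m < (bpbOrder v p).length := by omega
      have htake : (bpbOrder v p).take (m + 1) = (bpbOrder v p).take m ++ [(bpbOrder v p)[m]] := by
        simp
      have hstep : run (m + 1) = wStep M v p B (run m) (bpbOrder v p)[m] := by
        rw [hrun (m + 1), hrun m, htake, List.foldl_append]
        rfl
      have hnot : (bpbOrder v p)[m] ∉ ((bpbOrder v p).take m).toFinset := by
        have h1 : ((bpbOrder v p).take (m + 1)).Nodup := hnd.sublist (List.take_sublist _ _)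
        rw [htake, List.nodup_append] at h1
        intro h2
        exact h1.2.2 _ (List.mem_toFinset.1 h2) _ (List.mem_singleton_self _) rfl
      have hs := (hnostop (m + 1) hm).1
      have hs0 := (hnostop m (by omega)).1
      have hset : ((bpbOrder v p).take (m + 1)).toFinset
          = insert (bpbOrder v p)[m] ((bpbOrder v p).take m).toFinset := by
        rw [htake]
        ext x
        simp only [List.mem_toFinset, List.mem_append, List.mem_singleton, Finset.mem_insert]
        tauto
      have hst := GInv.step hE ih hnot
      rw [hset]
      rw [hstep] at hs ⊢
      unfold wStep at hs ⊢
      simp only [hs0, Bool.false_eq_true, if_false] at hs ⊢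
      generalize (if (bpbOrder v p)[m] ∈ M.closure (↑(run m).1 : Set (Fin n)) then
        (insert (bpbOrder v p)[m] (run m).1).erase (swapOut M v (run m).1 (bpbOrder v p)[m])
        else insert (bpbOrder v p)[m] (run m).1) = G' at hs hst ⊢
      by_cases hb : (∑ j ∈ G', p j) > B
      · simp [hb] at hs
      · rw [if_neg hb]
        exact hst
  have h := main k le_rfl
  exact ⟨h.1, h.2.1, fun T hTS hT => h.optimal hv T hTS hT⟩
end
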